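/- For every valid online translation strategy σ, every function f : ℝ → ℝ, and every real c > 0, there exists a nonempty finite stream L of pieces such that OPT(L) = c and ALG_σ(L) > f(OPT(L))·OPT(L), where the cost is the area of the bounding box. In particular, no online algorithm for area minimization with translations only has a competitive ratio bounded by any function of OPT. -/

import Mathlib

open Set

/-- A piece is a pair (w,h) of (intended positive) real numbers. -/
abbrev Piece := ℝ × ℝ

/-- Both edge lengths of the piece are positive. -/
def PiecePos (p : Piece) : Prop := 0 < p.1 ∧ 0 < p.2

/-- The axis-parallel closed rectangle obtained by placing piece `p` by
translation at the point `q`. -/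
def placedRect (p : Piece) (q : ℝ × ℝ) : Set (ℝ × ℝ) :=
  Set.Icc q.1 (q.1 + p.1) ×ˢ Set.Icc q.2 (q.2 + p.2)

/-- Width of the axis-parallel bounding box of a set in the plane. -/
noncomputable def boxWidth (S : Set (ℝ × ℝ)) : ℝ :=
  sSup (Prod.fst '' S) - sInf (Prod.fst '' S)

/-- Height of the axis-parallel bounding box of a set in the plane. -/
noncomputable def boxHeight (S : Set (ℝ × ℝ)) : ℝ :=
  sSup (Prod.snd '' S) - sInf (Prod.snd '' S)

/-! ### Translations only -/

/-- `pos` is a packing (by translations) of the list `L` of pieces: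
the placed rectangles have pairwise disjoint interiors. -/
def IsPacking (L : List Piece) (pos : Fin L.length → ℝ × ℝ) : Prop :=
  ∀ i j : Fin L.length, i ≠ j →
    Disjoint (interior (placedRect (L.get i) (pos i)))
             (interior (placedRect (L.get j) (pos j)))

/-- The union of the placed rectangles. -/
def packedSet (L : List Piece) (pos : Fin L.length → ℝ × ℝ) : Set (ℝ × ℝ) :=
  ⋃ i : Fin L.length, placedRect (L.get i) (pos i)

/-- Perimeter of the bounding box of a packing. -/
noncomputable def periCost (L : List Piece) (pos : Fin L.length → ℝ × ℝ) : ℝ :=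
  2 * (boxWidth (packedSet L pos) + boxHeight (packedSet L pos))

/-- Area of the bounding box of a packing. -/
noncomputable def areaCost (L : List Piece) (pos : Fin L.length → ℝ × ℝ) : ℝ :=
  boxWidth (packedSet L pos) * boxHeight (packedSet L pos)

/-- Optimal offline bounding-box perimeter for the pieces of `L`. -/
noncomputable def optPeri (L : List Piece) : ℝ :=
  sInf { c | ∃ pos : Fin L.length → ℝ × ℝ, IsPacking L pos ∧ periCost L pos = c }

/-- Optimal offline bounding-box area for the pieces of `L`. -/
noncomputable def optArea (L : List Piece) : ℝ :=
  sInf { c | ∃ pos : Fin L.length → ℝ × ℝ, IsPacking L pos ∧ areaCost L pos = c }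

/-- The positions chosen by the online strategy `σ` on the stream `L`:
the `i`-th piece is placed at the point chosen by `σ` as a function of the
first `i+1` pieces. -/
def onlinePos (σ : List Piece → ℝ × ℝ) (L : List Piece) :
    Fin L.length → ℝ × ℝ :=
  fun i => σ (L.take ((i : ℕ) + 1))

/-- `σ` is a valid online translation strategy: on every stream of pieces it
produces a packing. -/
def StrategyValid (σ : List Piece → ℝ × ℝ) : Prop :=
  ∀ L : List Piece, (∀ p ∈ L, PiecePos p) → IsPacking L (onlinePos σ L)

/-- Perimeter of the bounding box of the packing produced by `σ` on `L`. -/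
noncomputable def algPeri (σ : List Piece → ℝ × ℝ) (L : List Piece) : ℝ :=
  periCost L (onlinePos σ L)

/-- Area of the bounding box of the packing produced by `σ` on `L`. -/
noncomputable def algArea (σ : List Piece → ℝ × ℝ) (L : List Piece) : ℝ :=
  areaCost L (onlinePos σ L)

/-! ### Rotations by 90° allowed -/

/-- The piece `p` in the orientation given by `r`: rotated by 90° if `r` is
`true`. -/
def orient (p : Piece) (r : Bool) : Piece := if r then (p.2, p.1) else p

/-- `pos, rot` is a packing with rotations of the list `L` of pieces. -/
def IsRotPacking (L : List Piece) (pos : Fin L.length → ℝ × ℝ)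
    (rot : Fin L.length → Bool) : Prop :=
  ∀ i j : Fin L.length, i ≠ j →
    Disjoint (interior (placedRect (orient (L.get i) (rot i)) (pos i)))
             (interior (placedRect (orient (L.get j) (rot j)) (pos j)))

/-- The union of the placed (possibly rotated) rectangles. -/
def packedRotSet (L : List Piece) (pos : Fin L.length → ℝ × ℝ)
    (rot : Fin L.length → Bool) : Set (ℝ × ℝ) :=
  ⋃ i : Fin L.length, placedRect (orient (L.get i) (rot i)) (pos i)

/-- Perimeter of the bounding box of a packing with rotations. -/
noncomputable def periRotCost (L : List Piece) (pos : Fin L.length → ℝ × ℝ)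
    (rot : Fin L.length → Bool) : ℝ :=
  2 * (boxWidth (packedRotSet L pos rot) + boxHeight (packedRotSet L pos rot))

/-- Area of the bounding box of a packing with rotations. -/
noncomputable def areaRotCost (L : List Piece) (pos : Fin L.length → ℝ × ℝ)
    (rot : Fin L.length → Bool) : ℝ :=
  boxWidth (packedRotSet L pos rot) * boxHeight (packedRotSet L pos rot)

/-- Optimal offline bounding-box perimeter with rotations allowed. -/
noncomputable def optRotPeri (L : List Piece) : ℝ :=
  sInf { c | ∃ (pos : Fin L.length → ℝ × ℝ) (rot : Fin L.length → Bool),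
    IsRotPacking L pos rot ∧ periRotCost L pos rot = c }

/-- Optimal offline bounding-box area with rotations allowed. -/
noncomputable def optRotArea (L : List Piece) : ℝ :=
  sInf { c | ∃ (pos : Fin L.length → ℝ × ℝ) (rot : Fin L.length → Bool),
    IsRotPacking L pos rot ∧ areaRotCost L pos rot = c }

/-- The positions chosen by the online rotation strategy `σ` on the stream `L`. -/
def onlineRotPos (σ : List Piece → (ℝ × ℝ) × Bool) (L : List Piece) :
    Fin L.length → ℝ × ℝ :=
  fun i => (σ (L.take ((i : ℕ) + 1))).1

/-- The orientations chosen by the online rotation strategy `σ` on the stream `L`. -/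
def onlineRot (σ : List Piece → (ℝ × ℝ) × Bool) (L : List Piece) :
    Fin L.length → Bool :=
  fun i => (σ (L.take ((i : ℕ) + 1))).2

/-- `σ` is a valid online rotation strategy: on every stream of pieces it
produces a packing with rotations. -/
def RotStrategyValid (σ : List Piece → (ℝ × ℝ) × Bool) : Prop :=
  ∀ L : List Piece, (∀ p ∈ L, PiecePos p) →
    IsRotPacking L (onlineRotPos σ L) (onlineRot σ L)

/-- Perimeter of the bounding box of the packing produced by `σ` on `L`. -/
noncomputable def algRotPeri (σ : List Piece → (ℝ × ℝ) × Bool) (L : List Piece) : ℝ :=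
  periRotCost L (onlineRotPos σ L) (onlineRot σ L)

/-- Area of the bounding box of the packing produced by `σ` on `L`. -/
noncomputable def algRotArea (σ : List Piece → (ℝ × ℝ) × Bool) (L : List Piece) : ℝ :=
  areaRotCost L (onlineRotPos σ L) (onlineRot σ L)

/-! ### Square pieces, bounding-square cost -/

/-- The axis-parallel closed square of side `s` placed at the point `q`. -/
def placedSq (s : ℝ) (q : ℝ × ℝ) : Set (ℝ × ℝ) :=
  Set.Icc q.1 (q.1 + s) ×ˢ Set.Icc q.2 (q.2 + s)

/-- `pos` is a packing of the list `L` of square pieces. -/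
def IsSqPacking (L : List ℝ) (pos : Fin L.length → ℝ × ℝ) : Prop :=
  ∀ i j : Fin L.length, i ≠ j →
    Disjoint (interior (placedSq (L.get i) (pos i)))
             (interior (placedSq (L.get j) (pos j)))

/-- The union of the placed squares. -/
def packedSqSet (L : List ℝ) (pos : Fin L.length → ℝ × ℝ) : Set (ℝ × ℝ) :=
  ⋃ i : Fin L.length, placedSq (L.get i) (pos i)

/-- Area of the smallest axis-parallel square containing all placed squares. -/
noncomputable def sqCost (L : List ℝ) (pos : Fin L.length → ℝ × ℝ) : ℝ :=
  (max (boxWidth (packedSqSet L pos)) (boxHeight (packedSqSet L pos))) ^ 2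

/-- Optimal offline bounding-square area for the square pieces of `L`. -/
noncomputable def optSq (L : List ℝ) : ℝ :=
  sInf { c | ∃ pos : Fin L.length → ℝ × ℝ, IsSqPacking L pos ∧ sqCost L pos = c }

/-- The positions chosen by the online strategy `σ` on the stream `L` of
square pieces. -/
def onlineSqPos (σ : List ℝ → ℝ × ℝ) (L : List ℝ) : Fin L.length → ℝ × ℝ :=
  fun i => σ (L.take ((i : ℕ) + 1))

/-- `σ` is a valid online translation strategy for square pieces. -/
def SqStrategyValid (σ : List ℝ → ℝ × ℝ) : Prop :=
  ∀ L : List ℝ, (∀ s ∈ L, 0 < s) → IsSqPacking L (onlineSqPos σ L)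

/-- Bounding-square area of the packing produced by `σ` on `L`. -/
noncomputable def algSq (σ : List ℝ → ℝ × ℝ) (L : List ℝ) : ℝ :=
  sqCost L (onlineSqPos σ L)

/-! ### Bounding boxes -/

theorem subset_bounding_box {S : Set (ℝ × ℝ)} (hS : IsCompact S) :
    S ⊆ Icc (sInf (Prod.fst '' S)) (sSup (Prod.fst '' S)) ×ˢ
      Icc (sInf (Prod.snd '' S)) (sSup (Prod.snd '' S)) := by
  intro x hx
  have h1 := hS.image continuous_fst
  have h2 := hS.image continuous_snd
  exact ⟨⟨csInf_le h1.bddBelow ⟨x, hx, rfl⟩, le_csSup h1.bddAbove ⟨x, hx, rfl⟩⟩,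
    ⟨csInf_le h2.bddBelow ⟨x, hx, rfl⟩, le_csSup h2.bddAbove ⟨x, hx, rfl⟩⟩⟩

theorem boxWidth_mono {S T : Set (ℝ × ℝ)} (hST : S ⊆ T) (hS : S.Nonempty) (hT : IsCompact T) :
    boxWidth S ≤ boxWidth T := by
  have h := hT.image continuous_fst
  exact sub_le_sub (csSup_le_csSup h.bddAbove (hS.image _) (image_mono hST))
    (csInf_le_csInf h.bddBelow (hS.image _) (image_mono hST))

theorem boxHeight_mono {S T : Set (ℝ × ℝ)} (hST : S ⊆ T) (hS : S.Nonempty) (hT : IsCompact T) :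
    boxHeight S ≤ boxHeight T := by
  have h := hT.image continuous_snd
  exact sub_le_sub (csSup_le_csSup h.bddAbove (hS.image _) (image_mono hST))
    (csInf_le_csInf h.bddBelow (hS.image _) (image_mono hST))

theorem boxWidth_nonneg {S : Set (ℝ × ℝ)} (hS : IsCompact S) : 0 ≤ boxWidth S :=
  sub_nonneg.2 (Real.sInf_le_sSup _ (hS.image continuous_fst).bddBelow
    (hS.image continuous_fst).bddAbove)

theorem boxHeight_nonneg {S : Set (ℝ × ℝ)} (hS : IsCompact S) : 0 ≤ boxHeight S :=
  sub_nonneg.2 (Real.sInf_le_sSup _ (hS.image continuous_snd).bddBelow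
    (hS.image continuous_snd).bddAbove)

theorem isCompact_placedRect (p : Piece) (q : ℝ × ℝ) : IsCompact (placedRect p q) :=
  isCompact_Icc.prod isCompact_Icc

theorem placedRect_nonempty {p : Piece} (hp : PiecePos p) (q : ℝ × ℝ) :
    (placedRect p q).Nonempty :=
  (nonempty_Icc.2 (by linarith [hp.1])).prod (nonempty_Icc.2 (by linarith [hp.2]))

theorem boxWidth_placedRect {p : Piece} (hp : PiecePos p) (q : ℝ × ℝ) :
    boxWidth (placedRect p q) = p.1 := by
  have h1 : q.1 ≤ q.1 + p.1 := by linarith [hp.1]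
  have h2 : q.2 ≤ q.2 + p.2 := by linarith [hp.2]
  rw [boxWidth, placedRect, fst_image_prod _ (nonempty_Icc.2 h2), csSup_Icc h1, csInf_Icc h1]
  ring

theorem boxHeight_placedRect {p : Piece} (hp : PiecePos p) (q : ℝ × ℝ) :
    boxHeight (placedRect p q) = p.2 := by
  have h1 : q.1 ≤ q.1 + p.1 := by linarith [hp.1]
  have h2 : q.2 ≤ q.2 + p.2 := by linarith [hp.2]
  rw [boxHeight, placedRect, snd_image_prod (nonempty_Icc.2 h1), csSup_Icc h2, csInf_Icc h2]
  ring

theorem interior_placedRect (p : Piece) (q : ℝ × ℝ) :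
    interior (placedRect p q) = Ioo q.1 (q.1 + p.1) ×ˢ Ioo q.2 (q.2 + p.2) := by
  rw [placedRect, interior_prod_eq, interior_Icc, interior_Icc]

theorem isCompact_packedSet (L : List Piece) (pos : Fin L.length → ℝ × ℝ) :
    IsCompact (packedSet L pos) :=
  isCompact_iUnion fun _ => isCompact_placedRect _ _

theorem packedSet_nonempty {L : List Piece} (hL : L ≠ []) (hpos : ∀ p ∈ L, PiecePos p)
    (pos : Fin L.length → ℝ × ℝ) : (packedSet L pos).Nonempty := by
  have i : Fin L.length := ⟨0, List.length_pos_iff.2 hL⟩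
  exact (placedRect_nonempty (hpos _ (L.get_mem i)) (pos i)).mono
    (subset_iUnion (fun i => placedRect (L.get i) (pos i)) i)

/-- The area of a bounding box is at most that of any enclosing rectangle. -/
theorem areaCost_le_of_subset {L : List Piece} (hL : L ≠ []) (hpos : ∀ p ∈ L, PiecePos p)
    {pos : Fin L.length → ℝ × ℝ} {w h : ℝ}
    (hsub : ∀ i, placedRect (L.get i) (pos i) ⊆ Icc 0 w ×ˢ Icc 0 h) :
    areaCost L pos ≤ w * h := by
  have hsub' : packedSet L pos ⊆ placedRect (w, h) (0, 0) := by
    simpa [packedSet, placedRect] using hsub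
  have hne := packedSet_nonempty hL hpos pos
  have i : Fin L.length := ⟨0, List.length_pos_iff.2 hL⟩
  have hp := hpos _ (L.get_mem i)
  have hp' : PiecePos (w, h) := by
    have h0 : pos i ∈ Icc 0 w ×ˢ Icc 0 h :=
      hsub i ⟨⟨le_rfl, by linarith [hp.1]⟩, ⟨le_rfl, by linarith [hp.2]⟩⟩
    have h1 : pos i + L.get i ∈ Icc 0 w ×ˢ Icc 0 h :=
      hsub i ⟨⟨by simpa using hp.1.le, le_rfl⟩, ⟨by simpa using hp.2.le, le_rfl⟩⟩
    have e1 := h1.1.2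
    have e2 := h1.2.2
    rw [Prod.fst_add] at e1
    rw [Prod.snd_add] at e2
    constructor
    · change 0 < w
      linarith [h0.1.1, hp.1]
    · change 0 < h
      linarith [h0.2.1, hp.2]
  have hc := isCompact_placedRect (w, h) (0, 0)
  have h1 := boxWidth_mono hsub' hne hc
  have h2 := boxHeight_mono hsub' hne hc
  rw [boxWidth_placedRect hp'] at h1
  rw [boxHeight_placedRect hp'] at h2
  exact mul_le_mul h1 h2 (boxHeight_nonneg (isCompact_packedSet _ _)) hp'.1.le

/-- The total area of the pieces is at most the area of the bounding box of any packing. -/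
theorem sum_area_le_areaCost {L : List Piece} (hpos : ∀ p ∈ L, PiecePos p)
    {pos : Fin L.length → ℝ × ℝ} (hpack : IsPacking L pos) :
    (L.map fun p => p.1 * p.2).sum ≤ areaCost L pos := by
  have hc := isCompact_packedSet L pos
  have hW := boxWidth_nonneg hc
  have hH := boxHeight_nonneg hc
  have hsub : (⋃ i, interior (placedRect (L.get i) (pos i))) ⊆ packedSet L pos :=
    iUnion_mono fun _ => interior_subset
  have hle := MeasureTheory.measure_mono (μ := MeasureTheory.volume)
    (hsub.trans (subset_bounding_box hc))
  rw [MeasureTheory.measure_iUnion (fun i j hij => hpack i j hij)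
    (fun i => isOpen_interior.measurableSet), tsum_fintype] at hle
  have hvol : ∀ i, MeasureTheory.volume (interior (placedRect (L.get i) (pos i))) =
      ENNReal.ofReal ((L.get i).1 * (L.get i).2) := by
    intro i
    have hp := hpos _ (L.get_mem i)
    rw [interior_placedRect, MeasureTheory.Measure.volume_eq_prod,
      MeasureTheory.Measure.prod_prod, Real.volume_Ioo, Real.volume_Ioo,
      add_sub_cancel_left, add_sub_cancel_left, ENNReal.ofReal_mul hp.1.le]
  rw [MeasureTheory.Measure.volume_eq_prod, MeasureTheory.Measure.prod_prod, Real.volume_Icc,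
    Real.volume_Icc, ← MeasureTheory.Measure.volume_eq_prod,
    ← ENNReal.ofReal_mul (by exact hW), Finset.sum_congr rfl fun i _ => hvol i,
    ← ENNReal.ofReal_sum_of_nonneg fun i _ =>
      mul_nonneg (hpos _ (L.get_mem i)).1.le (hpos _ (L.get_mem i)).2.le,
    ENNReal.ofReal_le_ofReal_iff (by exact mul_nonneg hW hH)] at hle
  have hsum : (L.map fun p => p.1 * p.2).sum = ∑ i, (L.get i).1 * (L.get i).2 := by
    rw [← Fin.sum_univ_fun_getElem]
    rfl
  rw [hsum]
  exact hle

/-- A packing that wastes no area is optimal. -/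
theorem optArea_eq_of_tight {L : List Piece} (hpos : ∀ p ∈ L, PiecePos p) {c : ℝ}
    (hsum : (L.map fun p => p.1 * p.2).sum = c)
    {pos : Fin L.length → ℝ × ℝ} (hpack : IsPacking L pos) (hcost : areaCost L pos ≤ c) :
    optArea L = c := by
  have hlow : ∀ x ∈ { c | ∃ pos : Fin L.length → ℝ × ℝ, IsPacking L pos ∧ areaCost L pos = c },
      c ≤ x := by
    rintro x ⟨pos', h, rfl⟩
    exact hsum ▸ sum_area_le_areaCost hpos h
  exact le_antisymm ((csInf_le ⟨c, hlow⟩ ⟨pos, hpack, rfl⟩).trans hcost)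
    (le_csInf ⟨_, pos, hpack, rfl⟩ hlow)

/-! ### Equal squares followed by one long piece -/

theorem piecePos_of_mem_squares_append {n : ℕ} {s : ℝ} {q : Piece} (hs : 0 < s)
    (hq : PiecePos q) : ∀ p ∈ List.replicate n ((s, s) : Piece) ++ [q], PiecePos p := by
  intro p hp
  rcases List.mem_append.1 hp with h | h
  · rw [List.eq_of_mem_replicate h]
    exact ⟨hs, hs⟩
  · rw [List.mem_singleton.1 h]
    exact hq

theorem squares_append_get {n : ℕ} {s : ℝ} {q : Piece}
    (i : Fin (List.replicate n ((s, s) : Piece) ++ [q]).length) :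
    ((i : ℕ) < n ∧ (List.replicate n ((s, s) : Piece) ++ [q]).get i = (s, s)) ∨
      ((i : ℕ) = n ∧ (List.replicate n ((s, s) : Piece) ++ [q]).get i = q) := by
  have hi := i.2
  simp only [List.length_append, List.length_replicate, List.length_singleton] at hi
  rcases Nat.lt_succ_iff_lt_or_eq.1 hi with h | h
  · left
    exact ⟨h, by simp [h]⟩
  · right
    exact ⟨h, by simp [h]⟩

theorem isPacking_of_lt {L : List Piece} {pos : Fin L.length → ℝ × ℝ}
    (h : ∀ i j : Fin L.length, i < j →
      (pos i).1 + (L.get i).1 ≤ (pos j).1 ∨ (pos i).2 + (L.get i).2 ≤ (pos j).2) :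
    IsPacking L pos := by
  have key : ∀ i j : Fin L.length, i < j →
      Disjoint (interior (placedRect (L.get i) (pos i)))
        (interior (placedRect (L.get j) (pos j))) := by
    intro i j hij
    rw [interior_placedRect, interior_placedRect, Set.disjoint_left]
    rintro x ⟨⟨h1, h2⟩, ⟨h3, h4⟩⟩ ⟨⟨h5, h6⟩, ⟨h7, h8⟩⟩
    rcases h i j hij with h | h <;> linarith
  intro i j hij
  rcases lt_or_gt_of_ne hij with h | h
  · exact key i j h
  · exact (key j i h).symm

theorem optArea_squares_append_horizontal {n : ℕ} {s a : ℝ} (hs : 0 < s) (ha : 0 < a) :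
    optArea (List.replicate n ((s, s) : Piece) ++ [(a, s)]) = (n * s + a) * s := by
  have hpos := piecePos_of_mem_squares_append (n := n) (q := (a, s)) hs ⟨ha, hs⟩
  refine optArea_eq_of_tight hpos ?_ (pos := fun i => ((i : ℕ) * s, 0)) ?_ ?_
  · simp
    ring
  · refine isPacking_of_lt fun i j hij => Or.inl ?_
    have hj : ((i : ℕ) : ℝ) + 1 ≤ (j : ℕ) := by exact_mod_cast hij
    rcases squares_append_get i with ⟨-, h⟩ | ⟨h, -⟩
    · rw [h]
      nlinarith
    · rcases squares_append_get j with ⟨h', -⟩ | ⟨h', -⟩ <;> omega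
  · refine areaCost_le_of_subset (by simp) hpos fun i => ?_
    have h0 : 0 ≤ ((i : ℕ) : ℝ) * s := by positivity
    refine prod_mono (Icc_subset_Icc h0 ?_) (Icc_subset_Icc le_rfl ?_)
    · rcases squares_append_get i with ⟨hi, h⟩ | ⟨hi, h⟩
      · have hi' : ((i : ℕ) : ℝ) + 1 ≤ n := by exact_mod_cast hi
        rw [h]
        nlinarith
      · rw [h, hi]
    · rcases squares_append_get i with ⟨-, h⟩ | ⟨-, h⟩ <;> (rw [h]; simp)

theorem optArea_squares_append_vertical {n : ℕ} {s a : ℝ} (hs : 0 < s) (ha : 0 < a) :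
    optArea (List.replicate n ((s, s) : Piece) ++ [(s, a)]) = s * (n * s + a) := by
  have hpos := piecePos_of_mem_squares_append (n := n) (q := (s, a)) hs ⟨hs, ha⟩
  refine optArea_eq_of_tight hpos ?_ (pos := fun i => (0, (i : ℕ) * s)) ?_ ?_
  · simp
    ring
  · refine isPacking_of_lt fun i j hij => Or.inr ?_
    have hj : ((i : ℕ) : ℝ) + 1 ≤ (j : ℕ) := by exact_mod_cast hij
    rcases squares_append_get i with ⟨-, h⟩ | ⟨h, -⟩
    · rw [h]
      nlinarith
    · rcases squares_append_get j with ⟨h', -⟩ | ⟨h', -⟩ <;> omega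
  · refine areaCost_le_of_subset (by simp) hpos fun i => ?_
    have h0 : 0 ≤ ((i : ℕ) : ℝ) * s := by positivity
    refine prod_mono (Icc_subset_Icc le_rfl ?_) (Icc_subset_Icc h0 ?_)
    · rcases squares_append_get i with ⟨-, h⟩ | ⟨-, h⟩ <;> (rw [h]; simp)
    · rcases squares_append_get i with ⟨hi, h⟩ | ⟨hi, h⟩
      · have hi' : ((i : ℕ) : ℝ) + 1 ≤ n := by exact_mod_cast hi
        rw [h]
        nlinarith
      · rw [h, hi]

/-! ### Extending a stream -/

theorem packedSet_onlinePos_subset_append (σ : List Piece → ℝ × ℝ) (L M : List Piece) :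
    packedSet L (onlinePos σ L) ⊆ packedSet (L ++ M) (onlinePos σ (L ++ M)) := by
  refine iUnion_subset fun i => ?_
  have hi : (i : ℕ) < (L ++ M).length := by
    rw [List.length_append]
    omega
  refine subset_iUnion_of_subset ⟨i, hi⟩ (Eq.subset ?_)
  have ht : (L ++ M).take ((i : ℕ) + 1) = L.take ((i : ℕ) + 1) :=
    List.take_append_of_le_length i.2
  simp [onlinePos, ht]

theorem placedRect_last_subset (σ : List Piece → ℝ × ℝ) (L : List Piece) (q : Piece) :
    placedRect q (σ (L ++ [q])) ⊆ packedSet (L ++ [q]) (onlinePos σ (L ++ [q])) := by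
  refine subset_iUnion_of_subset ⟨L.length, by simp⟩ (Eq.subset ?_)
  have ht : (L ++ [q]).take (L.length + 1) = L ++ [q] := List.take_of_length_le (by simp)
  simp only [onlinePos, ht]
  simp

/-- Appending a piece multiplies its width with the height already used. -/
theorem width_mul_boxHeight_le_algArea (σ : List Piece → ℝ × ℝ) {L : List Piece} (hL : L ≠ [])
    (hpos : ∀ p ∈ L, PiecePos p) {q : Piece} (hq : PiecePos q) :
    q.1 * boxHeight (packedSet L (onlinePos σ L)) ≤ algArea σ (L ++ [q]) := by
  have hc := isCompact_packedSet (L ++ [q]) (onlinePos σ (L ++ [q]))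
  have h1 := boxWidth_mono (placedRect_last_subset σ L q) (placedRect_nonempty hq _) hc
  rw [boxWidth_placedRect hq] at h1
  exact mul_le_mul h1 (boxHeight_mono (packedSet_onlinePos_subset_append σ L [q])
    (packedSet_nonempty hL hpos _) hc) (boxHeight_nonneg (isCompact_packedSet _ _))
    (boxWidth_nonneg hc)

/-- Appending a piece multiplies its height with the width already used. -/
theorem boxWidth_mul_height_le_algArea (σ : List Piece → ℝ × ℝ) {L : List Piece} (hL : L ≠ [])
    (hpos : ∀ p ∈ L, PiecePos p) {q : Piece} (hq : PiecePos q) :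
    boxWidth (packedSet L (onlinePos σ L)) * q.2 ≤ algArea σ (L ++ [q]) := by
  have hc := isCompact_packedSet (L ++ [q]) (onlinePos σ (L ++ [q]))
  have h1 := boxHeight_mono (placedRect_last_subset σ L q) (placedRect_nonempty hq _) hc
  rw [boxHeight_placedRect hq] at h1
  exact mul_le_mul (boxWidth_mono (packedSet_onlinePos_subset_append σ L [q])
    (packedSet_nonempty hL hpos _) hc) h1 hq.2.le (boxWidth_nonneg hc)

/-- For every valid online translation strategy `σ`, every
function `f : ℝ → ℝ` and every real `c > 0`, there exists a nonempty finite
stream `L` of pieces with `OPT(L) = c` and `ALG_σ(L) > f(OPT(L)) * OPT(L)`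
(area of the bounding box). -/
theorem area_translation_no_opt_function_bound
    (σ : List Piece → ℝ × ℝ) (hσ : StrategyValid σ)
    (f : ℝ → ℝ) (c : ℝ) (hc : 0 < c) :
    ∃ L : List Piece, L ≠ [] ∧ (∀ p ∈ L, PiecePos p) ∧
      optArea L = c ∧ f (optArea L) * optArea L < algArea σ L := by
  obtain ⟨m₀, hm₀⟩ := exists_nat_gt (f c * c / (c / 2))
  set m := m₀ + 1 with hm
  have hmpos : (0 : ℝ) < m := by positivity
  have hlarge : f c * c < m * (c / 2) := by
    rw [div_lt_iff₀ (by positivity)] at hm₀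
    push_cast [hm]
    linarith
  obtain ⟨r, hr, hrc⟩ : ∃ r : ℝ, 0 < r ∧ r * r = c / 2 :=
    ⟨√(c / 2), Real.sqrt_pos.2 (by positivity), Real.mul_self_sqrt (by positivity)⟩
  have hs : 0 < r / m := by positivity
  have ha : 0 < m * r := by positivity
  have hL : List.replicate (m * m) ((r / m, r / m) : Piece) ≠ [] := by simp [hm]
  have hpos : ∀ p ∈ List.replicate (m * m) ((r / m, r / m) : Piece), PiecePos p := by
    intro p hp
    rw [List.eq_of_mem_replicate hp]
    exact ⟨hs, hs⟩
  have harea := sum_area_le_areaCost hpos (hσ _ hpos)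
  have hsum : ((List.replicate (m * m) ((r / m, r / m) : Piece)).map
      fun p => p.1 * p.2).sum = r * r := by
    simp only [List.map_replicate, List.sum_replicate, nsmul_eq_mul, Nat.cast_mul]
    field_simp
  rw [hsum, areaCost] at harea
  rcases le_or_gt r (boxHeight (packedSet _ (onlinePos σ
    (List.replicate (m * m) ((r / m, r / m) : Piece))))) with hH | hH
  · have hq : PiecePos (m * r, r / m) := ⟨ha, hs⟩
    have hopt : optArea (List.replicate (m * m) ((r / m, r / m) : Piece) ++ [(m * r, r / m)])
        = c := by
      rw [optArea_squares_append_horizontal hs ha]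
      push_cast
      field_simp
      linarith
    refine ⟨_, by simp, piecePos_of_mem_squares_append hs hq, hopt, ?_⟩
    rw [hopt]
    have h := width_mul_boxHeight_le_algArea σ hL hpos hq
    have h' := mul_le_mul_of_nonneg_left hH ha.le
    rw [mul_assoc, hrc] at h'
    exact hlarge.trans_le (h'.trans h)
  · have hW : r ≤ boxWidth (packedSet _ (onlinePos σ
        (List.replicate (m * m) ((r / m, r / m) : Piece)))) := by
      by_contra! hW
      have := mul_lt_mul'' hW hH (boxWidth_nonneg (isCompact_packedSet _ _))
        (boxHeight_nonneg (isCompact_packedSet _ _))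
      linarith
    have hq : PiecePos (r / m, m * r) := ⟨hs, ha⟩
    have hopt : optArea (List.replicate (m * m) ((r / m, r / m) : Piece) ++ [(r / m, m * r)])
        = c := by
      rw [optArea_squares_append_vertical hs ha]
      push_cast
      field_simp
      linarith
    refine ⟨_, by simp, piecePos_of_mem_squares_append hs hq, hopt, ?_⟩
    rw [hopt]
    have h := boxWidth_mul_height_le_algArea σ hL hpos hq
    have h' := mul_le_mul_of_nonneg_right hW ha.le
    rw [mul_left_comm, hrc] at h'
    exact hlarge.trans_le (h'.trans h)
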